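/- Let q be a unital quantum channel on M_n and let A ∈ M_n satisfy Matrix.trace (q(A)ᴴ * q(A)) = Matrix.trace (Aᴴ * A) and Matrix.trace (q(Aᴴ)ᴴ * q(Aᴴ)) = Matrix.trace (A * Aᴴ). Then A belongs to the multiplicative domain of q: for every B ∈ M_n, q(A * B) = q(A) * q(B) and q(B * A) = q(B) * q(A). -/

import Mathlib

open Matrix

open scoped ComplexOrder in
theorem kraus_intertwine (n p : ℕ)
    (qk : Fin p → Matrix (Fin n) (Fin n) ℂ)
    (hu : ∑ k, qk k * (qk k)ᴴ = 1)
    (ht : ∑ k, (qk k)ᴴ * qk k = 1)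
    (A Q : Matrix (Fin n) (Fin n) ℂ)
    (hQ : Q = ∑ k, qk k * A * (qk k)ᴴ)
    (hA : Matrix.trace (Qᴴ * Q) = Matrix.trace (Aᴴ * A)) (k : Fin p) :
    A * (qk k)ᴴ = (qk k)ᴴ * Q := by
  have hQ' : Qᴴ = ∑ k, qk k * Aᴴ * (qk k)ᴴ := by
    rw [hQ, conjTranspose_sum]
    simp [conjTranspose_mul, mul_assoc]
  have h1 : ∑ k, (A * (qk k)ᴴ - (qk k)ᴴ * Q)ᴴ * (A * (qk k)ᴴ - (qk k)ᴴ * Q)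
      = ∑ k, qk k * (Aᴴ * A) * (qk k)ᴴ - Qᴴ * Q := by
    have e : ∀ k, (A * (qk k)ᴴ - (qk k)ᴴ * Q)ᴴ * (A * (qk k)ᴴ - (qk k)ᴴ * Q)
        = qk k * (Aᴴ * A) * (qk k)ᴴ - (qk k * Aᴴ * (qk k)ᴴ) * Q
          - Qᴴ * (qk k * A * (qk k)ᴴ) + Qᴴ * (qk k * (qk k)ᴴ) * Q := by
      intro k
      simp only [conjTranspose_sub, conjTranspose_mul, conjTranspose_conjTranspose]
      noncomm_ring
    simp only [e, Finset.sum_add_distrib, Finset.sum_sub_distrib]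
    rw [← Finset.sum_mul, ← Finset.mul_sum, ← Finset.sum_mul, ← Finset.mul_sum, hu, ← hQ', ← hQ]
    noncomm_ring
  have h2 : Matrix.trace (∑ k, qk k * (Aᴴ * A) * (qk k)ᴴ) = Matrix.trace (Aᴴ * A) := by
    have e : ∀ k, Matrix.trace (qk k * (Aᴴ * A) * (qk k)ᴴ)
        = Matrix.trace ((qk k)ᴴ * qk k * (Aᴴ * A)) := by
      intro k
      rw [Matrix.trace_mul_comm, mul_assoc]
    rw [Matrix.trace_sum]
    simp only [e]
    rw [← Matrix.trace_sum, ← Finset.sum_mul, ht, one_mul]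
  have h3 := congrArg Matrix.trace h1
  rw [Matrix.trace_sub, h2, hA, sub_self, Matrix.trace_sum,
    Finset.sum_eq_zero_iff_of_nonneg
      (fun k _ => (Matrix.posSemidef_conjTranspose_mul_self _).trace_nonneg)] at h3
  have h4 := h3 k (Finset.mem_univ k)
  rw [Matrix.trace_conjTranspose_mul_self_eq_zero_iff] at h4
  exact sub_eq_zero.mp h4

/-- Choi's multiplicative domain theorem, as used in the paper: if a unital
quantum channel `q` on `Mₙ` is GNS-norm preserving on both `A` and `Aᴴ`, then `A` lies in
the multiplicative domain of `q`. -/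
theorem norm_preserved_mem_multiplicative_domain
    (n p : ℕ)
    (q : Matrix (Fin n) (Fin n) ℂ → Matrix (Fin n) (Fin n) ℂ)
    (qk : Fin p → Matrix (Fin n) (Fin n) ℂ)
    (hq : ∀ A, q A = ∑ k, qk k * A * (qk k)ᴴ)
    (hq_unital : ∑ k, qk k * (qk k)ᴴ = 1)
    (hq_tp : ∑ k, (qk k)ᴴ * qk k = 1)
    (A : Matrix (Fin n) (Fin n) ℂ)
    (hA : Matrix.trace ((q A)ᴴ * q A) = Matrix.trace (Aᴴ * A))
    (hA' : Matrix.trace ((q Aᴴ)ᴴ * q Aᴴ) = Matrix.trace (A * Aᴴ)) :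
    ∀ B : Matrix (Fin n) (Fin n) ℂ,
      q (A * B) = q A * q B ∧ q (B * A) = q B * q A := by
  intro B
  have hs : q Aᴴ = (q A)ᴴ := by
    rw [hq, hq, conjTranspose_sum]
    simp [conjTranspose_mul, mul_assoc]
  have k1 := kraus_intertwine n p qk hq_unital hq_tp A (q A) (hq A) hA
  have k2 := kraus_intertwine n p qk hq_unital hq_tp Aᴴ (q Aᴴ) (hq Aᴴ)
    (by rw [hA', conjTranspose_conjTranspose])
  have k3 : ∀ k, qk k * A = q A * qk k := by
    intro k
    have := congrArg conjTranspose (k2 k)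
    simpa [hs, conjTranspose_mul] using this
  constructor
  · rw [hq (A * B), hq B, Finset.mul_sum]
    refine Finset.sum_congr rfl fun k _ => ?_
    rw [← mul_assoc, k3 k]
    simp only [mul_assoc]
  · rw [hq (B * A), hq B, Finset.sum_mul]
    refine Finset.sum_congr rfl fun k _ => ?_
    rw [mul_assoc, mul_assoc, k1 k]
    simp only [mul_assoc]
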